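/- arXiv:1611.02832 — 2 statements merged into one kernel-verified Lean document; each statement's English description precedes it below -/
import Mathlib

section
/- For every finite field K with q elements and every field extension L of K of degree 7, there exists a ∈ L not lying in K such that a^{q^i} + a^{q^j} + a^{q^k} ≠ 0 for all integers 0 ≤ i < j < k ≤ 6. -/
/-- A finite extension of a finite field with `q` elements contains an element whose conjugates
`x, x ^ q, x ^ q ^ 2, …` are linearly independent. -/
theorem FiniteField.exists_linearIndependent_pow_card_pow
    (K L : Type*) [Field K] [Fintype K] [Field L] [Algebra K L] [FiniteDimensional K L] :
    ∃ x : L, LinearIndependent K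
      fun n : Fin (Module.finrank K L) ↦ x ^ Fintype.card K ^ (n : ℕ) := by
  have : Finite L := Module.finite_of_finite K
  obtain ⟨x, hx⟩ := exists_linearIndependent_algEquiv_apply K L
  refine ⟨x, ?_⟩
  convert hx.comp _ (FiniteField.bijective_frobeniusAlgEquivOfAlgebraic_pow K L).injective
    using 2 with n
  simp [AlgEquiv.coe_pow, FiniteField.coe_frobeniusAlgEquivOfAlgebraic_iterate]


/-- For every finite field `K` with `q` elements and every field extension `L` of `K`
of degree `7`, there exists `a ∈ L` not lying in (the image of) `K` such that
`a^{q^i} + a^{q^j} + a^{q^k} ≠ 0` for all `0 ≤ i < j < k ≤ 6`. -/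
theorem exists_degree7_elt_no_three_conjugates_sum_zero
    (K L : Type*) [Field K] [Fintype K] [Field L] [Algebra K L]
    (q : ℕ) (hq : q = Fintype.card K)
    (hdeg : Module.finrank K L = 7) :
    ∃ a : L, a ∉ Set.range (algebraMap K L) ∧
      ∀ i j k : ℕ, i < j → j < k → k ≤ 6 →
        a ^ q ^ i + a ^ q ^ j + a ^ q ^ k ≠ 0 := by
  have : FiniteDimensional K L := Module.finite_of_finrank_pos (by lia)
  obtain ⟨a, ha⟩ := FiniteField.exists_linearIndependent_pow_card_pow K L
  rw [← hq, hdeg] at ha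
  refine ⟨a, ?_, fun i j k hij hjk hk h ↦ ?_⟩
  · rintro ⟨b, rfl⟩
    have h : (0 : Fin 7) = 1 := ha.injective (by simp [← map_pow, hq, FiniteField.pow_card])
    simp at h
  · let i' : Fin 7 := ⟨i, by lia⟩
    let j' : Fin 7 := ⟨j, by lia⟩
    let k' : Fin 7 := ⟨k, by lia⟩
    have hi : i' ∉ ({j', k'} : Finset (Fin 7)) := by simp [i', j', k']; lia
    have hj : j' ∉ ({k'} : Finset (Fin 7)) := by simp [j', k']; lia
    refine one_ne_zero (linearIndependent_iff'.mp ha {i', j', k'} (fun _ ↦ 1) ?_ i' (by simp))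
    rw [Finset.sum_insert hi, Finset.sum_insert hj, Finset.sum_singleton]
    simpa [i', j', k', add_assoc] using h
end

section
/- Let a ∈ L be an element not lying in K. Then a + a^q + a^{q⁴} ≠ 0. -/
open Polynomial in
/-- An element of an extension of a finite field `K` that is fixed by the Frobenius of `K`
lies in `K`. -/
theorem FiniteField.mem_range_algebraMap_of_pow_card_eq {K L : Type*} [Field K] [Fintype K]
    [Field L] [Algebra K L] {a : L} (h : a ^ Fintype.card K = a) :
    a ∈ Set.range (algebraMap K L) := by
  classical
  have hne : (X ^ Fintype.card K - X : L[X]) ≠ 0 :=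
    FiniteField.X_pow_card_sub_X_ne_zero L Fintype.one_lt_card
  have hsub : (Finset.univ.image (algebraMap K L)) ⊆
      (X ^ Fintype.card K - X : L[X]).roots.toFinset := by
    intro x hx
    obtain ⟨k, -, rfl⟩ := Finset.mem_image.mp hx
    simp [hne, ← map_pow, FiniteField.pow_card]
  have hcard : (X ^ Fintype.card K - X : L[X]).roots.toFinset.card ≤
      (Finset.univ.image (algebraMap K L)).card := by
    rw [Finset.card_image_of_injective _ (algebraMap K L).injective, Finset.card_univ]
    exact (Multiset.toFinset_card_le _).trans <| (card_roots' _).trans_eq <|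
      FiniteField.X_pow_card_sub_X_natDegree_eq L Fintype.one_lt_card
  have hmem : a ∈ (X ^ Fintype.card K - X : L[X]).roots.toFinset := by
    simp [hne, h]
  rw [← Finset.eq_of_subset_of_card_le hsub hcard] at hmem
  simpa using hmem


/-- Let `K` be a finite field with `q` elements and `L` a field extension of `K` of
degree `7`. If `a ∈ L` does not lie in (the image of) `K`, then
`a + a^q + a^{q⁴} ≠ 0`. -/
theorem add_pow_q_add_pow_q_four_ne_zero
    (K L : Type*) [Field K] [Fintype K] [Field L] [Algebra K L]
    (q : ℕ) (hq : q = Fintype.card K)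
    (hdeg : Module.finrank K L = 7)
    (a : L) (ha : a ∉ Set.range (algebraMap K L)) :
    a + a ^ q + a ^ q ^ 4 ≠ 0 := by
  subst hq
  intro h
  have : Module.Finite K L := Module.finite_of_finrank_pos (by omega)
  have : Fintype L := Module.fintypeOfFintype (Module.finBasisOfFinrankEq K L hdeg)
  set φ := FiniteField.frobeniusAlgHom K L
  have hφ (x : L) : x ^ Fintype.card K = φ x := rfl
  have hper : φ (φ (φ (φ (φ (φ (φ a)))))) = a := by
    have hpow := FiniteField.pow_card a
    rw [Module.card_eq_pow_finrank (K := K), hdeg] at hpow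
    simpa only [← hφ, ← pow_mul, pow_succ, pow_zero, one_mul, mul_assoc] using hpow
  have h₀ : a + φ a + φ (φ (φ (φ a))) = 0 := by
    simpa only [← hφ, ← pow_mul, pow_succ, pow_zero, one_mul, mul_assoc] using h
  have h₁ := congrArg φ h₀
  have h₂ := congrArg φ h₁
  have h₃ := congrArg φ h₂
  have h₄ := congrArg φ h₃
  have h₅ := congrArg φ h₄
  simp only [map_add, map_zero, hper] at h₂ h₃ h₄ h₅
  refine ha (FiniteField.mem_range_algebraMap_of_pow_card_eq ?_)
  rw [hφ]
  linear_combination h₂ - h₃ + h₄ - h₅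
end
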